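/- arXiv:2403.16337 — 11 statements merged into one kernel-verified Lean document; each statement's English description precedes it below -/
import Mathlib

section
/- Let N be a positive integer and a, p : Fin N → ℝ. Assume there exists an index j with p j ≤ 0 and an index k with p k ≥ 0. Let μ be the maximum of the finite set of candidate values consisting of (p j * a k − p k * a j)/(p j − p k) over all pairs (j,k) with p j < 0 < p k, together with the values a j over all indices j with p j = 0 (this candidate set is nonempty under the assumption). Then the infimum over t : ℝ of max_{j} (a j + p j * t) equals μ. -/
open Finset

/-- If every element of a finite set lies below every element of another, some element lies
between the two sets; neither set has to be nonempty. -/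
theorem exists_between_of_finite {α : Type*} [LinearOrder α] [Nonempty α] {s t : Set α}
    (hs : s.Finite) (ht : t.Finite) (h : ∀ x ∈ s, ∀ y ∈ t, x ≤ y) :
    ∃ z, (∀ x ∈ s, x ≤ z) ∧ ∀ y ∈ t, z ≤ y := by
  rcases s.eq_empty_or_nonempty with rfl | hne
  · obtain ⟨z, hz⟩ := ht.bddBelow
    exact ⟨z, by simp, fun y hy => hz hy⟩
  · obtain ⟨z, hzs, hz⟩ := s.exists_max_image id hs hne
    exact ⟨z, hz, h z hzs⟩

/-- The height at which a decreasing and an increasing line cross is a lower bound for their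
pointwise maximum. -/
theorem crossing_le_max {a b p q : ℝ} (hp : p < 0) (hq : 0 < q) (t : ℝ) :
    (p * b - q * a) / (p - q) ≤ max (a + p * t) (b + q * t) := by
  rw [div_le_iff_of_neg (by linarith)]
  nlinarith [mul_le_mul_of_nonneg_left (le_max_left (a + p * t) (b + q * t)) hq.le,
    mul_le_mul_of_nonpos_left (le_max_right (a + p * t) (b + q * t)) hp.le]

/-- If the height at which two lines of opposite slopes cross is at most `c`, then their sublevel
half-lines at height `c` overlap. -/
theorem div_le_div_of_crossing_le {a b p q c : ℝ} (hp : p < 0) (hq : 0 < q)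
    (h : (p * b - q * a) / (p - q) ≤ c) : (c - a) / p ≤ (c - b) / q := by
  rw [div_le_iff_of_neg (by linarith)] at h
  rw [div_le_iff_of_neg hp, div_mul_eq_mul_div, div_le_iff₀ hq]
  linarith

/-- Minimum value of a max-plus tropical Puiseux polynomial
`t ↦ max_j (a j + p j * t)`: if some exponent is `≤ 0` and some is `≥ 0`, the
infimum equals the maximum `μ` of the candidate values
`(p j * a k − p k * a j)/(p j − p k)` over pairs with `p j < 0 < p k` together
with the values `a j` over indices with `p j = 0`. -/
theorem iInf_maxplus_polynomial_eq {N : ℕ} (hN : 0 < N) (a p : Fin N → ℝ)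
    (hle : ∃ j, p j ≤ 0) (hge : ∃ k, 0 ≤ p k) (μ : ℝ)
    (hμ : IsGreatest
      ({v | ∃ j k, p j < 0 ∧ 0 < p k ∧ v = (p j * a k - p k * a j) / (p j - p k)}
        ∪ {v | ∃ j, p j = 0 ∧ v = a j}) μ) :
    haveI : Nonempty (Fin N) := ⟨⟨0, hN⟩⟩
    (⨅ t : ℝ, univ.sup' univ_nonempty fun j => a j + p j * t) = μ := by
  have hN' : Nonempty (Fin N) := ⟨⟨0, hN⟩⟩
  obtain ⟨hmem, hub⟩ := hμ
  have lower (t : ℝ) : μ ≤ univ.sup' univ_nonempty fun j => a j + p j * t := by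
    have hf (j : Fin N) : a j + p j * t ≤ univ.sup' univ_nonempty fun j => a j + p j * t :=
      le_sup' (fun j => a j + p j * t) (mem_univ j)
    rcases hmem with ⟨j, k, hj, hk, rfl⟩ | ⟨j, hj, rfl⟩
    · exact (crossing_le_max hj hk t).trans (max_le (hf j) (hf k))
    · simpa [hj] using hf j
  obtain ⟨t, hneg, hpos⟩ := exists_between_of_finite
    ((Set.toFinite {j | p j < 0}).image fun j => (μ - a j) / p j)
    ((Set.toFinite {k | 0 < p k}).image fun k => (μ - a k) / p k) (by
      rintro _ ⟨j, hj, rfl⟩ _ ⟨k, hk, rfl⟩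
      exact div_le_div_of_crossing_le hj hk (hub (Or.inl ⟨j, k, hj, hk, rfl⟩)))
  refine le_antisymm ((ciInf_le ⟨μ, Set.forall_mem_range.2 lower⟩ t).trans ?_) (le_ciInf lower)
  refine sup'_le _ _ fun j _ => ?_
  rcases lt_trichotomy (p j) 0 with hj | hj | hj
  · have := (div_le_iff_of_neg hj).1 (hneg _ ⟨j, hj, rfl⟩)
    linarith
  · simpa [hj] using hub (Or.inr ⟨j, hj, rfl⟩)
  · have := (le_div_iff₀ hj).1 (hpos _ ⟨j, hj, rfl⟩)
    linarith
end

section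
/- Let N be a positive integer and a, p : Fin N → ℝ. Assume there exists an index j with p j ≤ 0 and an index k with p k ≥ 0. Let μ be the maximum of the finite set of candidate values consisting of (p j * a k − p k * a j)/(p j − p k) over all pairs (j,k) with p j < 0 < p k, together with the values a j over all indices j with p j = 0. Then there exists t : ℝ with max_{j} (a j + p j * t) = μ; that is, the minimum of the function t ↦ max_{j} (a j + p j * t) is attained and equals μ. -/
open Finset

/-- Finitely many lower bounds, each at most every one of finitely many upper bounds, can be
separated by a point. -/
lemma Finset.exists_separating {α : Type*} [LinearOrder α] [Nonempty α]
    (L U : Finset α) (h : ∀ x ∈ L, ∀ y ∈ U, x ≤ y) :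
    ∃ t, (∀ x ∈ L, x ≤ t) ∧ ∀ y ∈ U, t ≤ y := by
  rcases L.eq_empty_or_nonempty with rfl | hL
  · obtain ⟨t, ht⟩ := U.bddBelow
    exact ⟨t, by simp, fun y hy => ht hy⟩
  · exact ⟨L.max' hL, fun x hx => L.le_max' x hx, fun y hy => h _ (L.max'_mem hL) y hy⟩

/-- Attainment of the minimum of a max-plus tropical Puiseux polynomial
`t ↦ max_j (a j + p j * t)`: under the hypotheses, there exists `t` where the
function attains its minimum value, and this minimum equals `μ`. -/
theorem maxplus_polynomial_min_attained {N : ℕ} (hN : 0 < N) (a p : Fin N → ℝ)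
    (hle : ∃ j, p j ≤ 0) (hge : ∃ k, 0 ≤ p k) (μ : ℝ)
    (hμ : IsGreatest
      ({v | ∃ j k, p j < 0 ∧ 0 < p k ∧ v = (p j * a k - p k * a j) / (p j - p k)}
        ∪ {v | ∃ j, p j = 0 ∧ v = a j}) μ) :
    haveI : Nonempty (Fin N) := ⟨⟨0, hN⟩⟩
    ∃ t : ℝ, (univ.sup' univ_nonempty fun j => a j + p j * t) = μ ∧
      ∀ s : ℝ, (univ.sup' univ_nonempty fun j => a j + p j * t)
        ≤ univ.sup' univ_nonempty fun j => a j + p j * s := by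
  have : Nonempty (Fin N) := ⟨⟨0, hN⟩⟩
  obtain ⟨hmem, hub⟩ := hμ
  have lower : ∀ s : ℝ, μ ≤ univ.sup' univ_nonempty fun j => a j + p j * s := by
    intro s
    rw [le_sup'_iff]
    rcases hmem with ⟨j, k, hj, hk, hv⟩ | ⟨j, hj, rfl⟩
    · by_contra! hlt
      rw [eq_div_iff (by linarith)] at hv
      have h₁ := mul_lt_mul_of_pos_left (hlt j (mem_univ j)) hk
      have h₂ := mul_lt_mul_of_neg_left (hlt k (mem_univ k)) hj
      linarith
    · exact ⟨j, mem_univ j, by simp [hj]⟩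
  obtain ⟨t, htL, htU⟩ := Finset.exists_separating
    ((univ.filter fun j => p j < 0).image fun j => (μ - a j) / p j)
    ((univ.filter fun k => 0 < p k).image fun k => (μ - a k) / p k) (by
      simp only [mem_image, mem_filter, mem_univ, true_and]
      rintro _ ⟨j, hj, rfl⟩ _ ⟨k, hk, rfl⟩
      have h := hub (Or.inl ⟨j, k, hj, hk, rfl⟩)
      rw [div_le_iff_of_neg (by linarith)] at h
      rw [div_le_iff_of_neg hj, div_mul_eq_mul_div, div_le_iff₀ hk]
      linarith)
  simp only [mem_image, mem_filter, mem_univ, true_and, forall_exists_index, and_imp,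
    forall_apply_eq_imp_iff₂] at htL htU
  have upper : (univ.sup' univ_nonempty fun j => a j + p j * t) ≤ μ := by
    refine sup'_le _ _ fun j _ => ?_
    rcases lt_trichotomy (p j) 0 with hj | hj | hj
    · have h := htL j hj
      rw [div_le_iff_of_neg hj] at h
      linarith
    · simpa [hj] using hub (Or.inr ⟨j, hj, rfl⟩)
    · have h := htU j hj
      rw [le_div_iff₀ hj] at h
      linarith
  exact ⟨t, le_antisymm upper (lower t), fun s => upper.trans (lower s)⟩
end

section
/- Let N be a positive integer and a, p : Fin N → ℝ. Assume there exists an index j with p j ≤ 0 and an index k with p k ≥ 0. Let μ be the maximum of the finite set of candidate values consisting of (p j * a k − p k * a j)/(p j − p k) over all pairs (j,k) with p j < 0 < p k, together with the values a j over all indices j with p j = 0. Then for every t : ℝ, one has max_{j} (a j + p j * t) = μ if and only if (for every j with p j < 0, (μ − a j)/p j ≤ t) and (for every j with p j > 0, t ≤ (μ − a j)/p j). -/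
open Finset

/-- The intersection height of a decreasing and an increasing line is a lower bound for
the larger of their values at every point. -/
theorem intersection_height_le_of_le {a b p q t s : ℝ} (hp : p < 0) (hq : 0 < q)
    (ha : a + p * t ≤ s) (hb : b + q * t ≤ s) : (p * b - q * a) / (p - q) ≤ s := by
  rw [div_le_iff_of_neg (by linarith)]
  nlinarith [mul_le_mul_of_nonneg_left ha hq.le, mul_le_mul_of_nonpos_left hb hp.le]

/-- Characterization of the minimizers of a max-plus tropical Puiseux
polynomial `t ↦ max_j (a j + p j * t)`: the value `μ` is attained at `t` iff
`(μ − a j)/p j ≤ t` for all `j` with `p j < 0` and `t ≤ (μ − a j)/p j` for all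
`j` with `p j > 0`. -/
theorem maxplus_polynomial_min_solution_set {N : ℕ} (hN : 0 < N) (a p : Fin N → ℝ)
    (hle : ∃ j, p j ≤ 0) (hge : ∃ k, 0 ≤ p k) (μ : ℝ)
    (hμ : IsGreatest
      ({v | ∃ j k, p j < 0 ∧ 0 < p k ∧ v = (p j * a k - p k * a j) / (p j - p k)}
        ∪ {v | ∃ j, p j = 0 ∧ v = a j}) μ) :
    haveI : Nonempty (Fin N) := ⟨⟨0, hN⟩⟩
    ∀ t : ℝ, (univ.sup' univ_nonempty fun j => a j + p j * t) = μ ↔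
      ((∀ j, p j < 0 → (μ - a j) / p j ≤ t) ∧ (∀ j, 0 < p j → t ≤ (μ - a j) / p j)) := by
  intro t
  have : Nonempty (Fin N) := ⟨⟨0, hN⟩⟩
  have hlow : μ ≤ univ.sup' univ_nonempty fun j => a j + p j * t := by
    have hline (j : Fin N) : a j + p j * t ≤ univ.sup' univ_nonempty fun j => a j + p j * t :=
      le_sup' (fun j => a j + p j * t) (mem_univ j)
    rcases hμ.1 with ⟨j, k, hj, hk, rfl⟩ | ⟨j, hj, rfl⟩
    · exact intersection_height_le_of_le hj hk (hline j) (hline k)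
    · simpa [hj] using hline j
  rw [← hlow.ge_iff_eq', sup'_le_iff]
  constructor
  · intro h
    refine ⟨fun j hj => ?_, fun j hj => ?_⟩
    · rw [div_le_iff_of_neg hj]
      linarith [h j (mem_univ j)]
    · rw [le_div_iff₀ hj]
      linarith [h j (mem_univ j)]
  · rintro ⟨hneg, hpos⟩ j -
    rcases lt_trichotomy (p j) 0 with hj | hj | hj
    · have h := hneg j hj
      rw [div_le_iff_of_neg hj] at h
      linarith
    · simpa [hj] using hμ.2 (Or.inr ⟨j, hj, rfl⟩)
    · have h := hpos j hj
      rw [le_div_iff₀ hj] at h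
      linarith
end

section
/- Let N be a positive integer, a : Fin N → ℝ with a j > 0 for all j, and p : Fin N → ℝ. Assume there exists an index j with p j ≤ 0 and an index k with p k ≥ 0. Let μ be the maximum of the finite set of candidate values consisting of (a j)^(−p k/(p j − p k)) * (a k)^(p j/(p j − p k)) (real powers) over all pairs (j,k) with p j < 0 < p k, together with the values a j over all indices j with p j = 0. Then the infimum over t ∈ (0,∞) of max_{j} (a j * t ^ (p j)) (real power) equals μ. -/
open Finset

/-- In a finite family of bounds, if every lower bound is at most every upper bound, some real
number satisfies all of them. -/
theorem exists_mem_upperBounds_inter_lowerBounds_of_finite {s t : Set ℝ} (hs : s.Finite)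
    (ht : t.Finite) (hst : ∀ x ∈ s, ∀ y ∈ t, x ≤ y) :
    ∃ c, c ∈ upperBounds s ∩ lowerBounds t := by
  rcases s.eq_empty_or_nonempty with rfl | hs'
  · obtain ⟨c, hc⟩ := ht.bddBelow
    exact ⟨c, by simp, hc⟩
  rcases t.eq_empty_or_nonempty with rfl | ht'
  · obtain ⟨c, hc⟩ := hs.bddAbove
    exact ⟨c, hc, by simp⟩
  exact exists_between_of_forall_le hs' ht' hst

/-- Finitely many affine functions on `ℝ` can be simultaneously at most `m` as soon as the constant
ones are at most `m` and every decreasing one meets every increasing one at height at most `m`. -/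
theorem exists_forall_add_mul_le {ι : Type*} [Finite ι] (b p : ι → ℝ) (m : ℝ)
    (hzero : ∀ j, p j = 0 → b j ≤ m)
    (hpair : ∀ j k, p j < 0 → 0 < p k →
      -(p k) / (p j - p k) * b j + p j / (p j - p k) * b k ≤ m) :
    ∃ s, ∀ j, b j + p j * s ≤ m := by
  obtain ⟨s, hlow, hupp⟩ := exists_mem_upperBounds_inter_lowerBounds_of_finite
    (s := (fun j => (m - b j) / p j) '' {j | p j < 0})
    (t := (fun k => (m - b k) / p k) '' {k | 0 < p k}) (Set.toFinite _) (Set.toFinite _) (by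
      rintro _ ⟨j, hj, rfl⟩ _ ⟨k, hk, rfl⟩
      have hj : p j < 0 := hj
      have hk : 0 < p k := hk
      have h := hpair j k hj hk
      have hlt : p j - p k < 0 := by linarith
      rw [div_mul_eq_mul_div, div_mul_eq_mul_div, ← add_div, div_le_iff_of_neg hlt] at h
      rw [le_div_iff₀ hk, div_mul_eq_mul_div, div_le_iff_of_neg hj]
      linarith)
  refine ⟨s, fun j => ?_⟩
  rcases lt_trichotomy (p j) 0 with hj | hj | hj
  · have h := hlow ⟨j, hj, rfl⟩
    rw [div_le_iff_of_neg hj] at h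
    linarith
  · simpa [hj] using hzero j hj
  · have h := hupp ⟨j, hj, rfl⟩
    rw [le_div_iff₀ hj] at h
    linarith

/-- The height at which a decreasing and an increasing affine function meet is at most their maximum
at any point. -/
theorem crossing_height_le_max {b c p q : ℝ} (hp : p < 0) (hq : 0 < q) (s : ℝ) :
    -q / (p - q) * b + p / (p - q) * c ≤ max (b + p * s) (c + q * s) := by
  have hlt : p - q < 0 := by linarith
  rw [div_mul_eq_mul_div, div_mul_eq_mul_div, ← add_div, div_le_iff_of_neg hlt]
  nlinarith [le_max_left (b + p * s) (c + q * s), le_max_right (b + p * s) (c + q * s)]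

theorem log_rpow_mul_rpow {x y : ℝ} (hx : 0 < x) (hy : 0 < y) (u v : ℝ) :
    Real.log (x ^ u * y ^ v) = u * Real.log x + v * Real.log y := by
  rw [Real.log_mul (by positivity) (by positivity), Real.log_rpow hx, Real.log_rpow hy]

theorem log_mul_rpow {x t : ℝ} (hx : 0 < x) (ht : 0 < t) (u : ℝ) :
    Real.log (x * t ^ u) = Real.log x + u * Real.log t := by
  rw [Real.log_mul (by positivity) (by positivity), Real.log_rpow ht]

/-- Minimum value of a max-algebra tropical Puiseux polynomial
`t ↦ max_j (a j * t ^ (p j))` over the positive reals: it equals the maximum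
`μ` of the candidate values `(a j)^(−p k/(p j − p k)) * (a k)^(p j/(p j − p k))`
over pairs with `p j < 0 < p k` together with the values `a j` over indices
with `p j = 0`. -/
theorem iInf_maxalgebra_polynomial_eq {N : ℕ} (hN : 0 < N) (a p : Fin N → ℝ)
    (ha : ∀ j, 0 < a j)
    (hle : ∃ j, p j ≤ 0) (hge : ∃ k, 0 ≤ p k) (μ : ℝ)
    (hμ : IsGreatest
      ({v | ∃ j k, p j < 0 ∧ 0 < p k ∧
          v = a j ^ (-(p k) / (p j - p k)) * a k ^ (p j / (p j - p k))}
        ∪ {v | ∃ j, p j = 0 ∧ v = a j}) μ) :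
    haveI : Nonempty (Fin N) := ⟨⟨0, hN⟩⟩
    (⨅ t : Set.Ioi (0 : ℝ), univ.sup' univ_nonempty fun j => a j * (t : ℝ) ^ (p j)) = μ := by
  have : Nonempty (Fin N) := ⟨⟨0, hN⟩⟩
  obtain ⟨hmem, hub⟩ := hμ
  have hμ_pos : 0 < μ := by
    rcases hmem with ⟨j, k, -, -, rfl⟩ | ⟨j, -, rfl⟩
    · exact mul_pos (Real.rpow_pos_of_pos (ha j) _) (Real.rpow_pos_of_pos (ha k) _)
    · exact ha j
  have hlower : ∀ t : Set.Ioi (0 : ℝ),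
      μ ≤ univ.sup' univ_nonempty fun j => a j * (t : ℝ) ^ (p j) := by
    rintro ⟨t, ht⟩
    have ht : 0 < t := ht
    rw [le_sup'_iff]
    rcases hmem with ⟨j, k, hj, hk, hv⟩ | ⟨j, hj, rfl⟩
    · have h := crossing_height_le_max (b := Real.log (a j)) (c := Real.log (a k)) hj hk
        (Real.log t)
      rw [← log_rpow_mul_rpow (ha j) (ha k), ← hv, ← log_mul_rpow (ha j) ht,
        ← log_mul_rpow (ha k) ht, le_max_iff] at h
      rcases h with h | h
      · exact ⟨j, mem_univ j, (Real.log_le_log_iff hμ_pos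
          (mul_pos (ha j) (Real.rpow_pos_of_pos ht _))).1 h⟩
      · exact ⟨k, mem_univ k, (Real.log_le_log_iff hμ_pos
          (mul_pos (ha k) (Real.rpow_pos_of_pos ht _))).1 h⟩
    · exact ⟨j, mem_univ j, by simp [hj]⟩
  obtain ⟨s, hs⟩ := exists_forall_add_mul_le (fun j => Real.log (a j)) p (Real.log μ)
    (fun j hj => Real.log_le_log (ha j) (hub (Or.inr ⟨j, hj, rfl⟩)))
    (fun j k hj hk => by
      rw [← log_rpow_mul_rpow (ha j) (ha k)]
      exact Real.log_le_log (mul_pos (Real.rpow_pos_of_pos (ha j) _)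
        (Real.rpow_pos_of_pos (ha k) _)) (hub (Or.inl ⟨j, k, hj, hk, rfl⟩)))
  have : Nonempty (Set.Ioi (0 : ℝ)) := ⟨⟨1, Set.mem_Ioi.2 one_pos⟩⟩
  refine le_antisymm ?_ (le_ciInf hlower)
  refine ciInf_le_of_le ⟨μ, Set.forall_mem_range.2 hlower⟩ ⟨Real.exp s, Real.exp_pos s⟩ ?_
  refine sup'_le _ _ fun j _ => ?_
  rw [← Real.log_le_log_iff (mul_pos (ha j) (Real.rpow_pos_of_pos (Real.exp_pos s) _)) hμ_pos,
    log_mul_rpow (ha j) (Real.exp_pos s), Real.log_exp]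
  exact hs j
end

section
/- Let M, N be positive integers, A : Fin M → Fin N → ℝ, and b : Fin M → ℝ. Define the residual vector z : Fin N → ℝ by z j = −max_{i} (A i j − b i), and define Δ = max_{i} (b i − max_{j} (A i j + z j)). Then for every x : Fin N → ℝ, the Chebyshev distance satisfies max_{i} |max_{j} (A i j + x j) − b i| ≥ Δ/2. -/
open Finset

/-- Lower bound half of the best approximate solution theorem for the max-plus
equation `A ⊗ x = b`: every `x` has Chebyshev approximation error at least
`Δ/2`, where `Δ = max_i (b i − max_j (A i j + z j))` and
`z j = −max_i (A i j − b i)`. -/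
theorem maxplus_error_lower_bound {M N : ℕ} (hM : 0 < M) (hN : 0 < N)
    (A : Fin M → Fin N → ℝ) (b : Fin M → ℝ) :
    haveI : Nonempty (Fin M) := ⟨⟨0, hM⟩⟩
    haveI : Nonempty (Fin N) := ⟨⟨0, hN⟩⟩
    let z : Fin N → ℝ := fun j => -(univ.sup' univ_nonempty fun i => A i j - b i)
    let Δ : ℝ := univ.sup' univ_nonempty fun i =>
      b i - univ.sup' univ_nonempty fun j => A i j + z j
    ∀ x : Fin N → ℝ,
      Δ / 2 ≤ univ.sup' univ_nonempty fun i =>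
        |(univ.sup' univ_nonempty fun j => A i j + x j) - b i| := by
  have : Nonempty (Fin M) := ⟨⟨0, hM⟩⟩
  have : Nonempty (Fin N) := ⟨⟨0, hN⟩⟩
  intro z Δ x
  set D : ℝ := univ.sup' univ_nonempty fun i =>
    |(univ.sup' univ_nonempty fun j => A i j + x j) - b i|
  have hdist : ∀ i, |(univ.sup' univ_nonempty fun j => A i j + x j) - b i| ≤ D := fun i =>
    le_sup' (fun i => |(univ.sup' univ_nonempty fun j => A i j + x j) - b i|) (mem_univ i)
  have hz : ∀ j, x j - D ≤ z j := by
    intro j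
    have hres : (univ.sup' univ_nonempty fun i => A i j - b i) ≤ D - x j := by
      refine sup'_le _ _ fun i _ => ?_
      have hle := le_sup' (fun j => A i j + x j) (mem_univ j)
      have habs := (abs_le.mp (hdist i)).2
      linarith
    change x j - D ≤ -(univ.sup' univ_nonempty fun i => A i j - b i)
    linarith
  have hΔ : Δ ≤ 2 * D := by
    refine sup'_le _ _ fun i _ => ?_
    have hmax : (univ.sup' univ_nonempty fun j => A i j + x j) ≤
        (univ.sup' univ_nonempty fun j => A i j + z j) + D := by
      refine sup'_le _ _ fun j _ => ?_
      have hle := le_sup' (fun j => A i j + z j) (mem_univ j)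
      linarith [hz j]
    have habs := (abs_le.mp (hdist i)).1
    linarith
  linarith
end

section
/- Let M, N be positive integers, A : Fin M → Fin N → ℝ, and b : Fin M → ℝ. Define the residual vector z : Fin N → ℝ by z j = −max_{i} (A i j − b i), and define Δ = max_{i} (b i − max_{j} (A i j + z j)). Define x* : Fin N → ℝ by x* j = Δ/2 + z j. Then max_{i} |max_{j} (A i j + x* j) − b i| = Δ/2. -/
open Finset

/-- Adding a constant to `z` shifts the max-plus product `max_j (a j + z j)` by that constant. -/
theorem sup'_add_const_add {ι : Type*} (s : Finset ι) (hs : s.Nonempty) (a z : ι → ℝ) (t : ℝ) :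
    (s.sup' hs fun j => a j + (t + z j)) = t + s.sup' hs fun j => a j + z j := by
  apply le_antisymm
  · refine sup'_le _ _ fun j hj => ?_
    linarith [le_sup' (fun j => a j + z j) hj]
  · rw [← le_sub_iff_add_le']
    refine sup'_le _ _ fun j hj => ?_
    linarith [le_sup' (fun j => a j + (t + z j)) hj]

/-- If the residual `r` is nonnegative and vanishes somewhere, then shifting it by half of its
maximum leaves a vector whose sup norm is exactly half of that maximum. -/
theorem sup'_abs_half_sup'_sub {ι : Type*} (s : Finset ι) (hs : s.Nonempty) (r : ι → ℝ)
    (hr : ∀ i ∈ s, 0 ≤ r i) (hr₀ : ∃ i ∈ s, r i = 0) :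
    (s.sup' hs fun i => |s.sup' hs r / 2 - r i|) = s.sup' hs r / 2 := by
  apply le_antisymm
  · refine sup'_le _ _ fun i hi => abs_le.mpr ⟨?_, ?_⟩
    · linarith [le_sup' r hi]
    · linarith [hr i hi]
  · obtain ⟨i, hi, hi₀⟩ := hr₀
    refine le_trans ?_ (le_sup' (fun i => |s.sup' hs r / 2 - r i|) hi)
    simpa only [hi₀, sub_zero] using le_abs_self (s.sup' hs r / 2)

/-- The best approximate solution `x* = Δ/2 + z` of the max-plus equation
`A ⊗ x = b` achieves Chebyshev approximation error exactly `Δ/2`, where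
`z j = −max_i (A i j − b i)` and `Δ = max_i (b i − max_j (A i j + z j))`. -/
theorem maxplus_best_solution_error {M N : ℕ} (hM : 0 < M) (hN : 0 < N)
    (A : Fin M → Fin N → ℝ) (b : Fin M → ℝ) :
    haveI : Nonempty (Fin M) := ⟨⟨0, hM⟩⟩
    haveI : Nonempty (Fin N) := ⟨⟨0, hN⟩⟩
    let z : Fin N → ℝ := fun j => -(univ.sup' univ_nonempty fun i => A i j - b i)
    let Δ : ℝ := univ.sup' univ_nonempty fun i =>
      b i - univ.sup' univ_nonempty fun j => A i j + z j
    let xstar : Fin N → ℝ := fun j => Δ / 2 + z j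
    (univ.sup' univ_nonempty fun i =>
      |(univ.sup' univ_nonempty fun j => A i j + xstar j) - b i|) = Δ / 2 := by
  intro z Δ xstar
  have hne : (univ : Finset (Fin M)).Nonempty := ⟨⟨0, hM⟩, mem_univ _⟩
  have hne' : (univ : Finset (Fin N)).Nonempty := ⟨⟨0, hN⟩, mem_univ _⟩
  have hz : ∀ i j, A i j + z j ≤ b i := fun i j => by
    have := le_sup' (fun i => A i j - b i) (mem_univ i)
    simp only [z]
    linarith
  have hc : ∀ i, (univ.sup' hne' fun j => A i j + z j) ≤ b i := fun i =>
    sup'_le _ _ fun j _ => hz i j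
  have hc₀ : ∃ i ∈ univ, b i - (univ.sup' hne' fun j => A i j + z j) = 0 := by
    obtain ⟨i, hi, h⟩ := exists_mem_eq_sup' hne fun i => A i ⟨0, hN⟩ - b i
    have hzi : z ⟨0, hN⟩ = -(A i ⟨0, hN⟩ - b i) := congrArg Neg.neg h
    have := le_sup' (fun j => A i j + z j) (mem_univ (⟨0, hN⟩ : Fin N))
    refine ⟨i, hi, ?_⟩
    linarith [hc i]
  refine Eq.trans (sup'_congr _ rfl fun i _ => ?_)
    (sup'_abs_half_sup'_sub univ hne (fun i => b i - univ.sup' hne' fun j => A i j + z j)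
      (fun i _ => sub_nonneg.mpr (hc i)) hc₀)
  simp only [xstar, sup'_add_const_add, sub_sub_eq_add_sub]
  rfl
end

section
/- Let M, N be positive integers, A : Fin M → Fin N → ℝ, and b : Fin M → ℝ. Define the residual vector z : Fin N → ℝ by z j = −max_{i} (A i j − b i), and define Δ = max_{i} (b i − max_{j} (A i j + z j)). Then the infimum over all x : Fin N → ℝ of the Chebyshev distance max_{i} |max_{j} (A i j + x j) − b i| equals Δ/2, and this infimum is attained. -/
open Finset

section MaxPlus

variable {ι κ : Type*}

section MulVec

variable [Fintype κ] [Nonempty κ]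

/-- The max-plus matrix-vector product. -/
noncomputable def maxPlusMulVec (A : ι → κ → ℝ) (x : κ → ℝ) (i : ι) : ℝ :=
  univ.sup' univ_nonempty fun j => A i j + x j

theorem maxPlusMulVec_le_iff {A : ι → κ → ℝ} {x : κ → ℝ} {i : ι} {c : ℝ} :
    maxPlusMulVec A x i ≤ c ↔ ∀ j, A i j + x j ≤ c := by
  simp [maxPlusMulVec]

theorem maxPlusMulVec_add_const (A : ι → κ → ℝ) (x : κ → ℝ) (c : ℝ) (i : ι) :
    maxPlusMulVec A (fun j => x j + c) i = maxPlusMulVec A x i + c := by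
  refine eq_of_forall_ge_iff fun d => ?_
  rw [← le_sub_iff_add_le, maxPlusMulVec_le_iff, maxPlusMulVec_le_iff]
  exact forall_congr' fun j => by rw [le_sub_iff_add_le, add_assoc]

theorem maxPlusMulVec_mono (A : ι → κ → ℝ) {x y : κ → ℝ} (h : x ≤ y) (i : ι) :
    maxPlusMulVec A x i ≤ maxPlusMulVec A y i :=
  maxPlusMulVec_le_iff.2 fun j =>
    (add_le_add_right (h j) _).trans (maxPlusMulVec_le_iff.1 le_rfl j)

end MulVec

section Residual

variable [Fintype ι] [Nonempty ι]

/-- The greatest solution `z` of the max-plus inequality `A ⊗ z ≤ b`. -/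
noncomputable def maxPlusResidual (A : ι → κ → ℝ) (b : ι → ℝ) (j : κ) : ℝ :=
  -(univ.sup' univ_nonempty fun i => A i j - b i)

theorem le_maxPlusResidual_iff {A : ι → κ → ℝ} {b : ι → ℝ} {j : κ} {c : ℝ} :
    c ≤ maxPlusResidual A b j ↔ ∀ i, A i j + c ≤ b i := by
  rw [maxPlusResidual, le_neg, sup'_le_iff]
  exact ⟨fun h i => by linarith [h i (mem_univ i)], fun h i _ => by linarith [h i]⟩

end Residual

variable [Fintype ι] [Nonempty ι] [Fintype κ] [Nonempty κ]

/-- The largest gap between `b` and `A ⊗ z`, where `z` is the residual vector. -/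
noncomputable def maxPlusGap (A : ι → κ → ℝ) (b : ι → ℝ) : ℝ :=
  univ.sup' univ_nonempty fun i => b i - maxPlusMulVec A (maxPlusResidual A b) i

/-- The Chebyshev distance between `A ⊗ x` and `b`. -/
noncomputable def maxPlusError (A : ι → κ → ℝ) (b : ι → ℝ) (x : κ → ℝ) : ℝ :=
  univ.sup' univ_nonempty fun i => |maxPlusMulVec A x i - b i|

theorem maxPlusGap_le_iff {A : ι → κ → ℝ} {b : ι → ℝ} {c : ℝ} :
    maxPlusGap A b ≤ c ↔ ∀ i, b i - maxPlusMulVec A (maxPlusResidual A b) i ≤ c := by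
  simp [maxPlusGap]

theorem maxPlusError_le_iff {A : ι → κ → ℝ} {b : ι → ℝ} {x : κ → ℝ} {c : ℝ} :
    maxPlusError A b x ≤ c ↔ ∀ i, |maxPlusMulVec A x i - b i| ≤ c := by
  simp [maxPlusError]

theorem maxPlusMulVec_residual_le (A : ι → κ → ℝ) (b : ι → ℝ) (i : ι) :
    maxPlusMulVec A (maxPlusResidual A b) i ≤ b i :=
  maxPlusMulVec_le_iff.2 fun _ => le_maxPlusResidual_iff.1 le_rfl i

theorem maxPlusGap_div_two_le_error (A : ι → κ → ℝ) (b : ι → ℝ) (x : κ → ℝ) :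
    maxPlusGap A b / 2 ≤ maxPlusError A b x := by
  set d := maxPlusError A b x with hd
  have habs : ∀ i, |maxPlusMulVec A x i - b i| ≤ d := maxPlusError_le_iff.1 hd.ge
  have hle : (fun j => x j + -d) ≤ maxPlusResidual A b := fun j =>
    le_maxPlusResidual_iff.2 fun i => by
      have := maxPlusMulVec_le_iff.1 (le_refl (maxPlusMulVec A x i)) j
      linarith [(abs_le.1 (habs i)).2]
  have hgap : maxPlusGap A b ≤ 2 * d := maxPlusGap_le_iff.2 fun i => by
    have := maxPlusMulVec_mono A hle i
    rw [maxPlusMulVec_add_const] at this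
    linarith [(abs_le.1 (habs i)).1]
  linarith

theorem maxPlusError_residual_add (A : ι → κ → ℝ) (b : ι → ℝ) :
    maxPlusError A b (fun j => maxPlusResidual A b j + maxPlusGap A b / 2) =
      maxPlusGap A b / 2 := by
  refine le_antisymm (maxPlusError_le_iff.2 fun i => ?_) (maxPlusGap_div_two_le_error A b _)
  have hlower := maxPlusMulVec_residual_le A b i
  have hupper := maxPlusGap_le_iff.1 (le_refl (maxPlusGap A b)) i
  rw [maxPlusMulVec_add_const, abs_le]
  constructor <;> linarith

theorem isLeast_range_maxPlusError (A : ι → κ → ℝ) (b : ι → ℝ) :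
    IsLeast (Set.range (maxPlusError A b)) (maxPlusGap A b / 2) :=
  ⟨⟨_, maxPlusError_residual_add A b⟩,
    Set.forall_mem_range.2 (maxPlusGap_div_two_le_error A b)⟩

end MaxPlus

/-- Best approximate solution theorem for the max-plus equation `A ⊗ x = b`:
the infimum over `x` of the Chebyshev distance between `A ⊗ x` and `b` equals
`Δ/2` and is attained, where `z j = −max_i (A i j − b i)` and
`Δ = max_i (b i − max_j (A i j + z j))`. -/
theorem maxplus_best_approximation {M N : ℕ} (hM : 0 < M) (hN : 0 < N)
    (A : Fin M → Fin N → ℝ) (b : Fin M → ℝ) :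
    haveI : Nonempty (Fin M) := ⟨⟨0, hM⟩⟩
    haveI : Nonempty (Fin N) := ⟨⟨0, hN⟩⟩
    let z : Fin N → ℝ := fun j => -(univ.sup' univ_nonempty fun i => A i j - b i)
    let Δ : ℝ := univ.sup' univ_nonempty fun i =>
      b i - univ.sup' univ_nonempty fun j => A i j + z j
    (⨅ x : Fin N → ℝ, univ.sup' univ_nonempty fun i =>
        |(univ.sup' univ_nonempty fun j => A i j + x j) - b i|) = Δ / 2 ∧
      ∃ x : Fin N → ℝ, (univ.sup' univ_nonempty fun i =>
        |(univ.sup' univ_nonempty fun j => A i j + x j) - b i|) = Δ / 2 := by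
  have : Nonempty (Fin M) := ⟨⟨0, hM⟩⟩
  have : Nonempty (Fin N) := ⟨⟨0, hN⟩⟩
  have h := isLeast_range_maxPlusError A b
  exact ⟨h.csInf_eq, h.1⟩
end

section
/- Let M, N be positive integers, A : Fin M → Fin N → ℝ with A i j > 0 for all i, j, and b : Fin M → ℝ with b i > 0 for all i. Define the residual vector z : Fin N → ℝ by z j = (max_{i} (A i j / b i))⁻¹, and define Δ = max_{i} (b i / max_{j} (A i j * z j)). Then the infimum over all x : Fin N → ℝ with x j > 0 for all j of max_{i} (max ((max_{j} A i j * x j) / b i, b i / (max_{j} A i j * x j))) equals the real square root √Δ. -/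
open Finset

section MaxMulVec

variable {ι κ : Type*} [Fintype κ] [Nonempty κ]

/-- The max-algebra matrix-vector product. -/
noncomputable def maxMulVec (A : ι → κ → ℝ) (x : κ → ℝ) (i : ι) : ℝ :=
  univ.sup' univ_nonempty fun j => A i j * x j

theorem le_maxMulVec (A : ι → κ → ℝ) (x : κ → ℝ) (i : ι) (j : κ) :
    A i j * x j ≤ maxMulVec A x i :=
  le_sup' (fun j => A i j * x j) (mem_univ j)

theorem maxMulVec_le {A : ι → κ → ℝ} {x : κ → ℝ} {i : ι} {c : ℝ}
    (h : ∀ j, A i j * x j ≤ c) : maxMulVec A x i ≤ c :=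
  sup'_le _ _ fun j _ => h j

theorem maxMulVec_pos {A : ι → κ → ℝ} (hA : ∀ i j, 0 < A i j) {x : κ → ℝ}
    (hx : ∀ j, 0 < x j) (i : ι) : 0 < maxMulVec A x i := by
  obtain ⟨j⟩ := ‹Nonempty κ›
  exact (mul_pos (hA i j) (hx j)).trans_le (le_maxMulVec A x i j)

theorem maxMulVec_mono {A : ι → κ → ℝ} (hA : ∀ i j, 0 < A i j) {x y : κ → ℝ}
    (h : ∀ j, x j ≤ y j) (i : ι) : maxMulVec A x i ≤ maxMulVec A y i :=
  maxMulVec_le fun j =>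
    (mul_le_mul_of_nonneg_left (h j) (hA i j).le).trans (le_maxMulVec A y i j)

theorem maxMulVec_const_mul (A : ι → κ → ℝ) {c : ℝ} (hc : 0 < c) (x : κ → ℝ) (i : ι) :
    maxMulVec A (fun j => c * x j) i = c * maxMulVec A x i := by
  apply le_antisymm
  · refine maxMulVec_le fun j => ?_
    rw [mul_left_comm]
    exact mul_le_mul_of_nonneg_left (le_maxMulVec A x i j) hc.le
  · rw [← le_div_iff₀' hc]
    refine maxMulVec_le fun j => ?_
    rw [le_div_iff₀' hc, mul_left_comm]
    exact le_maxMulVec A (fun j => c * x j) i j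

end MaxMulVec

section Residual

variable {ι κ : Type*} [Fintype ι] [Nonempty ι]

/-- The tropical distance between two positive vectors. -/
noncomputable def tropicalDist (u v : ι → ℝ) : ℝ :=
  univ.sup' univ_nonempty fun i => max (u i / v i) (v i / u i)

theorem tropicalDist_le_iff {u v : ι → ℝ} (hu : ∀ i, 0 < u i) (hv : ∀ i, 0 < v i) {c : ℝ} :
    tropicalDist u v ≤ c ↔ ∀ i, u i ≤ c * v i ∧ v i ≤ c * u i := by
  simp [tropicalDist, div_le_iff₀, hu, hv]

/-- The max-algebra residual of `b` by `A`. -/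
noncomputable def maxResidual (A : ι → κ → ℝ) (b : ι → ℝ) (j : κ) : ℝ :=
  (univ.sup' univ_nonempty fun i => A i j / b i)⁻¹

theorem maxResidual_pos {A : ι → κ → ℝ} (hA : ∀ i j, 0 < A i j) {b : ι → ℝ}
    (hb : ∀ i, 0 < b i) (j : κ) : 0 < maxResidual A b j := by
  obtain ⟨i⟩ := ‹Nonempty ι›
  exact inv_pos.2 ((div_pos (hA i j) (hb i)).trans_le
    (le_sup' (fun i => A i j / b i) (mem_univ i)))

theorem le_maxResidual_iff {A : ι → κ → ℝ} (hA : ∀ i j, 0 < A i j) {b : ι → ℝ}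
    (hb : ∀ i, 0 < b i) {j : κ} {c : ℝ} (hc : 0 < c) :
    c ≤ maxResidual A b j ↔ ∀ i, A i j * c ≤ b i := by
  rw [maxResidual, le_inv_comm₀ hc (inv_pos.1 (maxResidual_pos hA hb j))]
  simp only [sup'_le_iff, mem_univ, true_imp_iff]
  refine forall_congr' fun i => ?_
  rw [div_le_iff₀ (hb i), inv_mul_eq_div, le_div_iff₀ hc]

end Residual

section BestApproximation

variable {ι κ : Type*} [Fintype ι] [Nonempty ι] [Fintype κ] [Nonempty κ]

/-- The squared best approximation error of the equation `A ⊗ x = b`. -/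
noncomputable def maxDelta (A : ι → κ → ℝ) (b : ι → ℝ) : ℝ :=
  univ.sup' univ_nonempty fun i => b i / maxMulVec A (maxResidual A b) i

theorem maxDelta_le_iff {A : ι → κ → ℝ} (hA : ∀ i j, 0 < A i j) {b : ι → ℝ}
    (hb : ∀ i, 0 < b i) {c : ℝ} :
    maxDelta A b ≤ c ↔ ∀ i, b i ≤ c * maxMulVec A (maxResidual A b) i := by
  simp [maxDelta, div_le_iff₀, maxMulVec_pos hA (maxResidual_pos hA hb)]

theorem maxDelta_pos {A : ι → κ → ℝ} (hA : ∀ i j, 0 < A i j) {b : ι → ℝ}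
    (hb : ∀ i, 0 < b i) : 0 < maxDelta A b := by
  obtain ⟨i⟩ := ‹Nonempty ι›
  exact pos_of_mul_pos_left ((hb i).trans_le ((maxDelta_le_iff hA hb).1 le_rfl i))
    (maxMulVec_pos hA (maxResidual_pos hA hb) i).le

theorem maxMulVec_maxResidual_le {A : ι → κ → ℝ} (hA : ∀ i j, 0 < A i j) {b : ι → ℝ}
    (hb : ∀ i, 0 < b i) (i : ι) : maxMulVec A (maxResidual A b) i ≤ b i :=
  maxMulVec_le fun j => (le_maxResidual_iff hA hb (maxResidual_pos hA hb j)).1 le_rfl i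

/-- No positive vector approximates `A ⊗ x = b` better than `√Δ`. -/
theorem sqrt_maxDelta_le_tropicalDist {A : ι → κ → ℝ} (hA : ∀ i j, 0 < A i j) {b : ι → ℝ}
    (hb : ∀ i, 0 < b i) {x : κ → ℝ} (hx : ∀ j, 0 < x j) :
    √(maxDelta A b) ≤ tropicalDist (maxMulVec A x) b := by
  set D := tropicalDist (maxMulVec A x) b
  have h := (tropicalDist_le_iff (maxMulVec_pos hA hx) hb (c := D)).1 le_rfl
  have hD : 0 < D := by
    obtain ⟨i⟩ := ‹Nonempty ι›
    exact pos_of_mul_pos_left ((hb i).trans_le (h i).2) (maxMulVec_pos hA hx i).le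
  have hxz (j : κ) : x j ≤ D * maxResidual A b j := by
    rw [← div_le_iff₀' hD, le_maxResidual_iff hA hb (div_pos (hx j) hD)]
    intro i
    rw [← mul_div_assoc, div_le_iff₀' hD]
    exact (le_maxMulVec A x i j).trans (h i).1
  rw [Real.sqrt_le_left hD.le, maxDelta_le_iff hA hb]
  intro i
  calc b i ≤ D * maxMulVec A x i := (h i).2
    _ ≤ D * (D * maxMulVec A (maxResidual A b) i) := by
      rw [← maxMulVec_const_mul A hD (maxResidual A b)]
      exact mul_le_mul_of_nonneg_left (maxMulVec_mono hA hxz i) hD.le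
    _ = D ^ 2 * maxMulVec A (maxResidual A b) i := by ring

/-- The rescaled residual `√Δ • z` attains the error `√Δ`. -/
theorem tropicalDist_sqrt_maxDelta_mul_maxResidual_le {A : ι → κ → ℝ}
    (hA : ∀ i j, 0 < A i j) {b : ι → ℝ} (hb : ∀ i, 0 < b i) :
    tropicalDist (maxMulVec A fun j => √(maxDelta A b) * maxResidual A b j) b
      ≤ √(maxDelta A b) := by
  have hΔ := maxDelta_pos hA hb
  have hs := Real.sqrt_pos.2 hΔ
  rw [tropicalDist_le_iff
    (maxMulVec_pos hA fun j => mul_pos hs (maxResidual_pos hA hb j)) hb]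
  intro i
  rw [maxMulVec_const_mul A hs, ← mul_assoc, Real.mul_self_sqrt hΔ.le]
  exact ⟨mul_le_mul_of_nonneg_left (maxMulVec_maxResidual_le hA hb i) hs.le,
    (maxDelta_le_iff hA hb).1 le_rfl i⟩

/-- The best approximation error of `A ⊗ x = b` over positive `x` is attained and equals `√Δ`. -/
theorem isLeast_range_tropicalDist {A : ι → κ → ℝ} (hA : ∀ i j, 0 < A i j) {b : ι → ℝ}
    (hb : ∀ i, 0 < b i) :
    IsLeast (Set.range fun x : {x : κ → ℝ // ∀ j, 0 < x j} =>
      tropicalDist (maxMulVec A x) b) √(maxDelta A b) := by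
  have hz (j : κ) : 0 < √(maxDelta A b) * maxResidual A b j :=
    mul_pos (Real.sqrt_pos.2 (maxDelta_pos hA hb)) (maxResidual_pos hA hb j)
  refine ⟨⟨⟨_, hz⟩, le_antisymm (tropicalDist_sqrt_maxDelta_mul_maxResidual_le hA hb)
    (sqrt_maxDelta_le_tropicalDist hA hb hz)⟩, ?_⟩
  rintro _ ⟨x, rfl⟩
  exact sqrt_maxDelta_le_tropicalDist hA hb x.2

end BestApproximation

/-- Max-algebra form of the best approximate solution theorem: for positive
`A` and `b`, with `z j = (max_i (A i j / b i))⁻¹` and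
`Δ = max_i (b i / max_j (A i j * z j))`, the infimum over positive vectors `x`
of the tropical distance between `A ⊗ x` and `b` equals `√Δ`. -/
theorem maxalgebra_best_approximation {M N : ℕ} (hM : 0 < M) (hN : 0 < N)
    (A : Fin M → Fin N → ℝ) (hA : ∀ i j, 0 < A i j)
    (b : Fin M → ℝ) (hb : ∀ i, 0 < b i) :
    haveI : Nonempty (Fin M) := ⟨⟨0, hM⟩⟩
    haveI : Nonempty (Fin N) := ⟨⟨0, hN⟩⟩
    let z : Fin N → ℝ := fun j => (univ.sup' univ_nonempty fun i => A i j / b i)⁻¹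
    let Δ : ℝ := univ.sup' univ_nonempty fun i =>
      b i / univ.sup' univ_nonempty fun j => A i j * z j
    (⨅ x : {x : Fin N → ℝ // ∀ j, 0 < x j},
        univ.sup' univ_nonempty fun i =>
          max ((univ.sup' univ_nonempty fun j => A i j * (x : Fin N → ℝ) j) / b i)
            (b i / univ.sup' univ_nonempty fun j => A i j * (x : Fin N → ℝ) j))
      = Real.sqrt Δ := by
  have : Nonempty (Fin M) := ⟨⟨0, hM⟩⟩
  have : Nonempty (Fin N) := ⟨⟨0, hN⟩⟩
  exact (isLeast_range_tropicalDist hA hb).csInf_eq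
end

section
/- Let M, N be positive integers, x, y : Fin M → ℝ (samples), and p : Fin N → ℝ (exponents). Then max_{i} (y i − max_{j} (p j * x i − max_{k} (p j * x k − y k))) = max_{i} min_{j} max_{k} ((x k − x i) * p j + (y i − y k)). -/
open Finset

/-- Subtracting a finite maximum from a constant gives the minimum of the differences. -/
theorem sub_sup'_eq_inf' {ι α : Type*} [AddCommGroup α] [LinearOrder α] [IsOrderedAddMonoid α]
    {s : Finset ι} (hs : s.Nonempty) (c : α) (f : ι → α) :
    c - s.sup' hs f = s.inf' hs fun j => c - f j := by
  apply le_antisymm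
  · exact le_inf' _ _ fun j hj => sub_le_sub_left (le_sup' f hj) c
  · obtain ⟨j, hj, h⟩ := exists_mem_eq_sup' hs f
    rw [h]
    exact inf'_le (fun j => c - f j) hj

/-- Adding a constant to a finite maximum gives the maximum of the sums. -/
theorem add_sup'_eq_sup' {ι α : Type*} [AddCommGroup α] [LinearOrder α] [IsOrderedAddMonoid α]
    {s : Finset ι} (hs : s.Nonempty) (c : α) (f : ι → α) :
    c + s.sup' hs f = s.sup' hs fun j => c + f j := by
  apply le_antisymm
  · obtain ⟨j, hj, h⟩ := exists_mem_eq_sup' hs f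
    rw [h]
    exact le_sup' (fun j => c + f j) hj
  · exact sup'_le _ _ fun j hj => add_le_add_right (le_sup' f hj) c

/-- Scalar representation of the parameterized squared approximation error:
`max_i (y i − max_j (p j * x i − max_k (p j * x k − y k)))
  = max_i min_j max_k ((x k − x i) * p j + (y i − y k))`. -/
theorem maxplus_error_scalar_representation {M N : ℕ} (hM : 0 < M) (hN : 0 < N)
    (x y : Fin M → ℝ) (p : Fin N → ℝ) :
    haveI : Nonempty (Fin M) := ⟨⟨0, hM⟩⟩
    haveI : Nonempty (Fin N) := ⟨⟨0, hN⟩⟩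
    (univ.sup' univ_nonempty fun i =>
        y i - univ.sup' univ_nonempty fun j =>
          p j * x i - univ.sup' univ_nonempty fun k => p j * x k - y k)
      = univ.sup' univ_nonempty fun i =>
          univ.inf' univ_nonempty fun j =>
            univ.sup' univ_nonempty fun k => (x k - x i) * p j + (y i - y k) := by
  refine sup'_congr _ rfl fun i _ => ?_
  rw [sub_sup'_eq_inf']
  refine inf'_congr _ rfl fun j _ => ?_
  rw [← sub_add, add_sup'_eq_sup']
  exact sup'_congr _ rfl fun k _ => by ring
end

section
/- Let M, N be positive integers, x, y : Fin M → ℝ (samples), and p : Fin N → ℝ (exponents). Define Δ(p) = max_{i} (y i − max_{j} (p j * x i − max_{k} (p j * x k − y k))). Then the infimum over all coefficient vectors θ : Fin N → ℝ of the Chebyshev distance max_{i} |max_{j} (θ j + p j * x i) − y i| equals Δ(p)/2. -/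
open Finset

/-- Every coefficient vector `θ` has error at least half of the largest gap between `y` and the
greatest max-plus combination of the columns of `a` lying below `y`. -/
lemma maxplus_residual_half_le {ι κ : Type*} [Fintype ι] [Fintype κ] [Nonempty ι] [Nonempty κ]
    (a : κ → ι → ℝ) (y : ι → ℝ) (θ : κ → ℝ) :
    (univ.sup' univ_nonempty fun i =>
      y i - univ.sup' univ_nonempty fun j =>
        a j i - univ.sup' univ_nonempty fun k => a j k - y k) / 2 ≤
    univ.sup' univ_nonempty fun i => |(univ.sup' univ_nonempty fun j => θ j + a j i) - y i| := by
  set e := univ.sup' univ_nonempty fun i =>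
    |(univ.sup' univ_nonempty fun j => θ j + a j i) - y i|
  have herr (i : ι) : |(univ.sup' univ_nonempty fun j => θ j + a j i) - y i| ≤ e :=
    le_sup' (fun i => |(univ.sup' univ_nonempty fun j => θ j + a j i) - y i|) (mem_univ i)
  have hθ (j : κ) : (univ.sup' univ_nonempty fun k => a j k - y k) ≤ e - θ j := by
    refine sup'_le _ _ fun k _ => ?_
    have := le_sup' (fun j => θ j + a j k) (mem_univ j)
    linarith [(abs_le.mp (herr k)).2]
  suffices h : (univ.sup' univ_nonempty fun i =>
      y i - univ.sup' univ_nonempty fun j =>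
        a j i - univ.sup' univ_nonempty fun k => a j k - y k) ≤ 2 * e by linarith
  refine sup'_le _ _ fun i _ => ?_
  have hle : (univ.sup' univ_nonempty fun j => θ j + a j i) ≤
      (univ.sup' univ_nonempty fun j =>
        a j i - univ.sup' univ_nonempty fun k => a j k - y k) + e := by
    refine sup'_le _ _ fun j _ => ?_
    have := le_sup' (fun j => a j i - univ.sup' univ_nonempty fun k => a j k - y k) (mem_univ j)
    linarith [hθ j]
  linarith [(abs_le.mp (herr i)).1]

/-- Some coefficient vector has error at most half of the largest gap between `y` and the greatest
max-plus combination of the columns of `a` lying below `y`: shift that combination up by half of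
the gap. -/
lemma exists_maxplus_le_residual_half {ι κ : Type*} [Fintype ι] [Fintype κ] [Nonempty ι]
    [Nonempty κ] (a : κ → ι → ℝ) (y : ι → ℝ) :
    ∃ θ : κ → ℝ,
      (univ.sup' univ_nonempty fun i =>
        |(univ.sup' univ_nonempty fun j => θ j + a j i) - y i|) ≤
      (univ.sup' univ_nonempty fun i =>
        y i - univ.sup' univ_nonempty fun j =>
          a j i - univ.sup' univ_nonempty fun k => a j k - y k) / 2 := by
  set c : κ → ℝ := fun j => univ.sup' univ_nonempty fun k => a j k - y k
  set d := univ.sup' univ_nonempty fun i => y i - univ.sup' univ_nonempty fun j => a j i - c j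
  refine ⟨fun j => d / 2 - c j, sup'_le _ _ fun i _ => abs_le.mpr ⟨?_, ?_⟩⟩
  · have hd : y i - (univ.sup' univ_nonempty fun j => a j i - c j) ≤ d :=
      le_sup' (fun i => y i - univ.sup' univ_nonempty fun j => a j i - c j) (mem_univ i)
    have hle : (univ.sup' univ_nonempty fun j => a j i - c j) ≤
        (univ.sup' univ_nonempty fun j => d / 2 - c j + a j i) - d / 2 := by
      refine sup'_le _ _ fun j _ => ?_
      have := le_sup' (fun j => d / 2 - c j + a j i) (mem_univ j)
      linarith
    linarith
  · have hle : (univ.sup' univ_nonempty fun j => d / 2 - c j + a j i) ≤ y i + d / 2 := by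
      refine sup'_le _ _ fun j _ => ?_
      have : a j i - y i ≤ c j := le_sup' (fun k => a j k - y k) (mem_univ i)
      linarith
    linarith

/-- Discrete best approximation with fixed exponents: the infimum over
coefficient vectors `θ` of the Chebyshev distance between the values of the
max-plus polynomial `t ↦ max_j (θ j + p j * t)` at the sample inputs and the
sample outputs equals `Δ(p)/2`. -/
theorem maxplus_approximation_fixed_exponents {M N : ℕ} (hM : 0 < M) (hN : 0 < N)
    (x y : Fin M → ℝ) (p : Fin N → ℝ) :
    haveI : Nonempty (Fin M) := ⟨⟨0, hM⟩⟩
    haveI : Nonempty (Fin N) := ⟨⟨0, hN⟩⟩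
    let Δ : ℝ := univ.sup' univ_nonempty fun i =>
      y i - univ.sup' univ_nonempty fun j =>
        p j * x i - univ.sup' univ_nonempty fun k => p j * x k - y k
    (⨅ θ : Fin N → ℝ, univ.sup' univ_nonempty fun i =>
        |(univ.sup' univ_nonempty fun j => θ j + p j * x i) - y i|) = Δ / 2 := by
  have : Nonempty (Fin M) := ⟨⟨0, hM⟩⟩
  have : Nonempty (Fin N) := ⟨⟨0, hN⟩⟩
  have hlow := maxplus_residual_half_le (fun j i => p j * x i) y
  obtain ⟨θ, hθ⟩ := exists_maxplus_le_residual_half (fun j i => p j * x i) y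
  exact le_antisymm (ciInf_le_of_le ⟨_, Set.forall_mem_range.mpr hlow⟩ θ hθ) (le_ciInf hlow)
end

section
/- Let M, N be positive integers and g : Fin M → ℝ → ℝ a family of functions such that for each i the range of g i is bounded below. Then ⨅_{p : Fin N → ℝ} max_{i} min_{j} g i (p j) = ⨅_{f : Fin M → Fin N} max_{i} ⨅_{q : ℝ} (max over all k : Fin M with f k = f i of g k q); that is, minimizing over exponent vectors p the maximum over i of the minimum over coordinates of g i equals minimizing over all assignments f of indices to parts the maximum over i of the one-variable minimum of the pointwise maximum of the functions g k sharing the part of i. -/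
open Finset

/-- Reduction of the minimization over exponent vectors to a combinatorial
minimization over partitions: for bounded-below functions `g i`,
`⨅_p max_i min_j g i (p j)
  = ⨅_{f : Fin M → Fin N} max_i ⨅_q max_{k : f k = f i} g k q`. -/
theorem iInf_maxmin_eq_iInf_partitions {M N : ℕ} (hM : 0 < M) (hN : 0 < N)
    (g : Fin M → ℝ → ℝ) (hg : ∀ i, BddBelow (Set.range (g i))) :
    haveI : Nonempty (Fin M) := ⟨⟨0, hM⟩⟩
    haveI : Nonempty (Fin N) := ⟨⟨0, hN⟩⟩
    (⨅ p : Fin N → ℝ, univ.sup' univ_nonempty fun i =>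
        univ.inf' univ_nonempty fun j => g i (p j))
      = ⨅ f : Fin M → Fin N, univ.sup' univ_nonempty fun i =>
          ⨅ q : ℝ, (univ.filter fun k => f k = f i).sup'
            ⟨i, by simp⟩ fun k => g k q := by
  have : Nonempty (Fin M) := ⟨⟨0, hM⟩⟩
  have : Nonempty (Fin N) := ⟨⟨0, hN⟩⟩
  change (⨅ p : Fin N → ℝ, univ.sup' univ_nonempty fun i =>
        univ.inf' univ_nonempty fun j => g i (p j))
      = ⨅ f : Fin M → Fin N, univ.sup' univ_nonempty fun i =>
          ⨅ q : ℝ, (univ.filter fun k => f k = f i).sup'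
            ⟨i, by simp⟩ fun k => g k q
  choose b hb using hg
  have hb' : ∀ i q, b i ≤ g i q := fun i q => hb i ⟨q, rfl⟩
  have bdd_part : ∀ (f : Fin M → Fin N) (i : Fin M), BddBelow (Set.range fun q : ℝ =>
      (univ.filter fun k => f k = f i).sup' ⟨i, by simp⟩ fun k => g k q) := by
    intro f i
    refine ⟨b i, ?_⟩
    rintro _ ⟨q, rfl⟩
    exact (hb' i q).trans (le_sup' (fun k => g k q) (by simp))
  have bdd_exponents : BddBelow (Set.range fun p : Fin N → ℝ =>
      univ.sup' univ_nonempty fun i => univ.inf' univ_nonempty fun j => g i (p j)) := by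
    refine ⟨b ⟨0, hM⟩, ?_⟩
    rintro _ ⟨p, rfl⟩
    exact (le_inf' univ_nonempty (fun j => g ⟨0, hM⟩ (p j)) fun j _ => hb' _ _).trans
      (le_sup' (fun i => univ.inf' univ_nonempty fun j => g i (p j)) (mem_univ _))
  apply le_antisymm
  · refine le_ciInf fun f => le_of_forall_pos_le_add fun ε hε => ?_
    choose q hq using fun i => exists_lt_of_ciInf_lt (lt_add_of_pos_right
      (⨅ q : ℝ, (univ.filter fun k => f k = f i).sup' ⟨i, by simp⟩ fun k => g k q) hε)
    refine (ciInf_le bdd_exponents fun j => q (Function.invFun f j)).trans ?_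
    refine sup'_le _ _ fun i _ => ?_
    have hi : f (Function.invFun f (f i)) = f i := Function.invFun_eq ⟨i, rfl⟩
    set i' := Function.invFun f (f i) with hi'
    calc univ.inf' univ_nonempty (fun j => g i (q (Function.invFun f j)))
        ≤ g i (q i') := inf'_le (fun j => g i (q (Function.invFun f j))) (mem_univ (f i))
      _ ≤ _ := le_sup' (fun k => g k (q i')) (by simp [hi])
      _ ≤ _ := (hq i').le
      _ ≤ _ := by
        gcongr
        exact le_sup' (fun i => ⨅ q : ℝ, (univ.filter fun k => f k = f i).sup'
            ⟨i, by simp⟩ fun k => g k q) (mem_univ i')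
  · refine le_ciInf fun p => ?_
    choose f _ hf using fun i => exists_mem_eq_inf' univ_nonempty fun j => g i (p j)
    refine (ciInf_le (Set.finite_range _).bddBelow f).trans ?_
    refine sup'_le _ _ fun i _ => (ciInf_le (bdd_part f i) (p (f i))).trans ?_
    refine sup'_le _ _ fun k hk => ?_
    rw [← (mem_filter.mp hk).2, ← hf k]
    exact le_sup' (fun i => univ.inf' univ_nonempty fun j => g i (p j)) (mem_univ k)
end
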